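/- arXiv:1903.10037 — 2 statements merged into one kernel-verified Lean document; each statement's English description precedes it below -/
import Mathlib

section
/- The measure ν_V^{W,η} is a probability measure, i.e. ν_V^{W,η}(ℝ^V) = 1. -/
open MeasureTheory Matrix

noncomputable section

/-- The Schrödinger operator `H_β = 2·diag(β) − W`. -/
def Hmat {V : Type*} [Fintype V] [DecidableEq V] (W : Matrix V V ℝ) (β : V → ℝ) :
    Matrix V V ℝ :=
  2 • Matrix.diagonal β - W

/-- Density of the measure `ν_V^{W,η}` with respect to Lebesgue measure. -/
def nuDens {V : Type*} [Fintype V] [DecidableEq V] (W : Matrix V V ℝ) (η : V → ℝ)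
    (β : V → ℝ) : ENNReal :=
  Set.indicator {β : V → ℝ | (Hmat W β).PosDef}
    (fun β => ENNReal.ofReal
      ((2 / Real.pi) ^ ((Fintype.card V : ℝ) / 2) *
        Real.exp (-(1 / 2) * ((1 : V → ℝ) ⬝ᵥ (Hmat W β).mulVec 1
            + η ⬝ᵥ (Hmat W β)⁻¹.mulVec η) + η ⬝ᵥ (1 : V → ℝ)) /
        Real.sqrt (Hmat W β).det)) β

/-- The measure `ν_V^{W,η}`. -/
def nuMeas {V : Type*} [Fintype V] [DecidableEq V] (W : Matrix V V ℝ) (η : V → ℝ) :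
    Measure (V → ℝ) :=
  volume.withDensity (nuDens W η)

/-- The graph on `V` with an edge `{i,j}` whenever `W i j > 0`. -/
def graphOf {V : Type*} (W : Matrix V V ℝ) : SimpleGraph V :=
  SimpleGraph.fromRel (fun i j => 0 < W i j)

lemma gaussL : ∫⁻ x : ℝ, ENNReal.ofReal (Real.exp (-(1/2) * x ^ 2)) = ENNReal.ofReal √(2 * Real.pi) := by
  rw [← ofReal_integral_eq_lintegral_ofReal]
  · rw [integral_gaussian]; congr 2; ring
  · exact integrable_exp_neg_mul_sq (by norm_num)
  · exact Filter.Eventually.of_forall fun x => (Real.exp_pos _).le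

lemma gaussLIoi : ∫⁻ x : ℝ in Set.Ioi 0, ENNReal.ofReal (Real.exp (-(1/2) * x ^ 2)) =
    ENNReal.ofReal (√(2 * Real.pi) / 2) := by
  rw [← ofReal_integral_eq_lintegral_ofReal]
  · rw [integral_gaussian_Ioi]; congr 3; ring
  · exact (integrable_exp_neg_mul_sq (by norm_num)).integrableOn
  · exact Filter.Eventually.of_forall fun x => (Real.exp_pos _).le

lemma oneD_zero : ∫⁻ s in Set.Ioi (0:ℝ), ENNReal.ofReal (Real.exp (-(1/2) * s) / √s) =
    ENNReal.ofReal √(2 * Real.pi) := by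
  have himg : (fun s : ℝ => √s) '' Set.Ioi 0 = Set.Ioi 0 := by
    ext y; constructor
    · rintro ⟨x, hx, rfl⟩; exact Real.sqrt_pos.2 hx
    · intro hy; exact ⟨y ^ 2, Set.mem_Ioi.2 (pow_pos (Set.mem_Ioi.1 hy) 2), Real.sqrt_sq (le_of_lt hy)⟩
  have h := lintegral_image_eq_lintegral_abs_deriv_mul (s := Set.Ioi (0:ℝ)) (f := fun s => √s)
    (f' := fun s => 1 / (2 * √s)) measurableSet_Ioi
    (fun x hx => (Real.hasDerivAt_sqrt (ne_of_gt hx)).hasDerivWithinAt)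
    (fun x hx y hy hxy => (Real.sqrt_inj (le_of_lt hx) (le_of_lt hy)).1 hxy)
    (fun x => ENNReal.ofReal (Real.exp (-(1/2) * x ^ 2)))
  rw [himg, gaussLIoi] at h
  have h2 : ∫⁻ s in Set.Ioi (0:ℝ), ENNReal.ofReal (Real.exp (-(1/2) * s) / √s) =
      ∫⁻ s in Set.Ioi (0:ℝ), ENNReal.ofReal 2 * (ENNReal.ofReal |1 / (2 * √s)| *
        ENNReal.ofReal (Real.exp (-(1/2) * √s ^ 2))) := by
    refine setLIntegral_congr_fun measurableSet_Ioi fun s hs => ?_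
    have hs' : 0 < √s := Real.sqrt_pos.2 hs
    rw [abs_of_pos (by positivity), ← ENNReal.ofReal_mul (by positivity),
      ← ENNReal.ofReal_mul (by positivity), Real.sq_sqrt (le_of_lt hs)]
    congr 1; field_simp
  rw [h2, lintegral_const_mul' _ _ (by simp), ← h, ← ENNReal.ofReal_mul (by norm_num)]
  congr 1; ring

lemma oneD_pos (c : ℝ) (hc : 0 < c) :
    ∫⁻ s in Set.Ioi (0:ℝ), ENNReal.ofReal (Real.exp (-(1/2) * (s + c ^ 2 / s) + c) / √s) =
    ENNReal.ofReal √(2 * Real.pi) := by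
  set f : ℝ → ℝ := fun s => √s - c / √s with hf
  set f' : ℝ → ℝ := fun s => 1 / 2 * (1 / √s + c / (s * √s)) with hf'
  set g : ℝ → ENNReal := fun s =>
    ENNReal.ofReal (Real.exp (-(1/2) * (s + c ^ 2 / s) + c) / √s) with hg
  set g2 : ℝ → ENNReal := fun s =>
    ENNReal.ofReal (c * Real.exp (-(1/2) * (s + c ^ 2 / s) + c) / (s * √s)) with hg2
  have gm : Measurable g := by fun_prop
  have hmono : StrictMonoOn f (Set.Ioi 0) := by
    intro x hx y hy hxy
    have h1 : 0 < √x := Real.sqrt_pos.2 hx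
    have h2 : √x < √y := Real.sqrt_lt_sqrt (le_of_lt hx) hxy
    have h3 : c / √y < c / √x := div_lt_div_of_pos_left hc h1 h2
    simp only [hf]; linarith
  have himg : f '' Set.Ioi 0 = Set.univ := by
    refine Set.eq_univ_of_forall fun u => ?_
    have hd : |u| < √(u ^ 2 + 4 * c) := by
      rw [← Real.sqrt_sq_eq_abs]; exact Real.sqrt_lt_sqrt (sq_nonneg _) (by linarith)
    set r := √(u ^ 2 + 4 * c) with hr
    have hr2 : r ^ 2 = u ^ 2 + 4 * c := Real.sq_sqrt (by positivity)
    have hpos : 0 < (u + r) / 2 := by have := neg_abs_le u; linarith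
    refine ⟨((u + r) / 2) ^ 2, pow_pos hpos 2, ?_⟩
    simp only [hf]
    rw [Real.sqrt_sq hpos.le]
    have : u + r ≠ 0 := by intro h; rw [h] at hpos; norm_num at hpos
    field_simp
    nlinarith
  have hA := lintegral_image_eq_lintegral_abs_deriv_mul (s := Set.Ioi (0:ℝ)) (f := f)
    (f' := f') measurableSet_Ioi (fun x hx => by
      have h1 : 0 < √x := Real.sqrt_pos.2 hx
      have h0 := Real.hasDerivAt_sqrt (ne_of_gt hx)
      have := h0.sub ((hasDerivAt_const x c).div h0 h1.ne')
      refine (this.congr_deriv ?_).hasDerivWithinAt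
      have h2 : √x ^ 2 = x := Real.sq_sqrt (le_of_lt hx)
      simp only [hf']
      rw [h2]
      have hx' : x ≠ 0 := ne_of_gt hx
      field_simp
      ring)
    hmono.injOn (fun x => ENNReal.ofReal (Real.exp (-(1/2) * x ^ 2)))
  rw [himg, Measure.restrict_univ, gaussL] at hA
  have himg2 : (fun s : ℝ => c ^ 2 / s) '' Set.Ioi 0 = Set.Ioi 0 := by
    ext y; constructor
    · rintro ⟨x, hx, rfl⟩; exact Set.mem_Ioi.2 (div_pos (by positivity) (Set.mem_Ioi.1 hx))
    · intro hy
      have hy' : y ≠ 0 := ne_of_gt hy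
      exact ⟨c ^ 2 / y, Set.mem_Ioi.2 (div_pos (by positivity) (Set.mem_Ioi.1 hy)), by simp only; field_simp⟩
  have hB := lintegral_image_eq_lintegral_abs_deriv_mul (s := Set.Ioi (0:ℝ))
    (f := fun s => c ^ 2 / s)
    (f' := fun s => - (c ^ 2 / s ^ 2)) measurableSet_Ioi (fun x hx => by
      have := (hasDerivAt_const x (c ^ 2)).div (hasDerivAt_id x) (ne_of_gt hx)
      refine (this.congr_deriv ?_).hasDerivWithinAt
      simp; ring)
    (fun x hx y hy hxy => by
      have hx' : x ≠ 0 := ne_of_gt hx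
      have hy' : y ≠ 0 := ne_of_gt hy
      simp only at hxy
      field_simp at hxy
      exact hxy.symm) g
  rw [himg2] at hB
  have hB2 : ∫⁻ s in Set.Ioi (0:ℝ), ENNReal.ofReal |-(c ^ 2 / s ^ 2)| * g (c ^ 2 / s) =
      ∫⁻ s in Set.Ioi (0:ℝ), g2 s := by
    refine setLIntegral_congr_fun measurableSet_Ioi fun s hs => ?_
    have hs0 : 0 < s := hs
    have hs' : 0 < √s := Real.sqrt_pos.2 hs
    simp only [hg, hg2]
    rw [abs_neg, abs_of_pos (by positivity), ← ENNReal.ofReal_mul (by positivity),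
      Real.sqrt_div (by positivity), Real.sqrt_sq hc.le]
    congr 1
    have e : c ^ 2 / s + c ^ 2 / (c ^ 2 / s) = s + c ^ 2 / s := by field_simp; ring
    rw [e]
    have h2 : √s ^ 2 = s := Real.sq_sqrt hs0.le
    generalize Real.exp _ = E
    field_simp
    rw [h2]
    ring
  have hA2 : ∫⁻ s in Set.Ioi (0:ℝ), ENNReal.ofReal |f' s| *
      ENNReal.ofReal (Real.exp (-(1/2) * (f s) ^ 2)) =
      ∫⁻ s in Set.Ioi (0:ℝ), ENNReal.ofReal (1/2) * (g s + g2 s) := by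
    refine setLIntegral_congr_fun measurableSet_Ioi fun s hs => ?_
    have hs0 : 0 < s := hs
    have hs' : 0 < √s := Real.sqrt_pos.2 hs
    have hf0 : 0 < f' s := by simp only [hf']; positivity
    simp only [hg, hg2]
    rw [abs_of_pos hf0, ← ENNReal.ofReal_mul hf0.le, ← ENNReal.ofReal_add (by positivity)
      (by positivity), ← ENNReal.ofReal_mul (by positivity)]
    congr 1
    have h2 : √s ^ 2 = s := Real.sq_sqrt hs0.le
    have e : -(1/2) * (f s) ^ 2 = -(1/2) * (s + c ^ 2 / s) + c := by
      simp only [hf]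
      rw [sub_sq, div_pow, h2]
      field_simp
      ring
    rw [e]
    simp only [hf']
    generalize Real.exp _ = E
    ring
  rw [hA2, lintegral_const_mul' _ _ (by simp), lintegral_add_left gm, ← hB2, ← hB, ← two_mul,
    ← mul_assoc] at hA
  have : ENNReal.ofReal (1/2) * 2 = 1 := by
    rw [← ENNReal.ofReal_ofNat 2, ← ENNReal.ofReal_mul (by norm_num)]; norm_num
  rw [this, one_mul] at hA
  exact hA.symm

lemma oneD (c : ℝ) (hc : 0 ≤ c) :
    ∫⁻ s in Set.Ioi (0:ℝ), ENNReal.ofReal (Real.exp (-(1/2) * (s + c ^ 2 / s) + c) / √s) =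
    ENNReal.ofReal √(2 * Real.pi) := by
  rcases hc.eq_or_lt with rfl | h
  · simpa using oneD_zero
  · exact oneD_pos c h

/-- The one-dimensional integral after the affine substitution `s = 2 b - q`. -/
lemma oneD_shift (q c : ℝ) (hc : 0 ≤ c) :
    ∫⁻ b : ℝ, Set.indicator {b : ℝ | 0 < 2 * b - q} (fun b => ENNReal.ofReal
      ((2 / Real.pi) ^ ((1:ℝ) / 2) * (Real.exp (-(1/2) * ((2 * b - q) + c ^ 2 / (2 * b - q)) + c)
        / √(2 * b - q)))) b = 1 := by
  have hm : MeasurableSet {b : ℝ | 0 < 2 * b - q} :=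
    measurableSet_lt measurable_const (by fun_prop)
  rw [lintegral_indicator hm]
  have himg : (fun b : ℝ => 2 * b - q) '' {b : ℝ | 0 < 2 * b - q} = Set.Ioi 0 := by
    ext y; constructor
    · rintro ⟨x, hx, rfl⟩; exact hx
    · intro hy
      have hy' : 0 < y := hy
      exact ⟨(y + q) / 2, by change 0 < 2 * ((y + q) / 2) - q; linarith, by simp only; ring⟩
  have h := lintegral_image_eq_lintegral_abs_deriv_mul (s := {b : ℝ | 0 < 2 * b - q})
    (f := fun b => 2 * b - q) (f' := fun _ => 2) hm
    (fun x hx => by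
      have := ((hasDerivAt_id x).const_mul 2).sub_const q
      simpa using this.hasDerivWithinAt)
    (fun x hx y hy hxy => by simp only at hxy; linarith)
    (fun s => ENNReal.ofReal (Real.exp (-(1/2) * (s + c ^ 2 / s) + c) / √s))
  rw [himg, oneD c hc, lintegral_const_mul' _ _ (by simp)] at h
  have hp : (0:ℝ) ≤ (2 / Real.pi) ^ ((1:ℝ) / 2) := by positivity
  simp_rw [ENNReal.ofReal_mul hp]
  rw [lintegral_const_mul' _ _ (by simp)]
  have e : ENNReal.ofReal ((2 / Real.pi) ^ ((1:ℝ) / 2)) =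
      ENNReal.ofReal ((2 / Real.pi) ^ ((1:ℝ) / 2) / 2) * ENNReal.ofReal |2| := by
    rw [← ENNReal.ofReal_mul (by positivity)]; norm_num
  rw [e, mul_assoc, ← h, ← ENNReal.ofReal_mul (by positivity), ← Real.sqrt_eq_rpow,
    div_mul_eq_mul_div, ← Real.sqrt_mul (by positivity)]
  have : 2 / Real.pi * (2 * Real.pi) = 2 ^ 2 := by field_simp
  rw [this, Real.sqrt_sq (by norm_num)]
  norm_num

/-- Entrywise nonnegativity of the solution of `A x = y` for a positive definite Z-matrix. -/
lemma mmatrix_nonneg {U : Type*} [Fintype U] [DecidableEq U] (A : Matrix U U ℝ) (hA : A.PosDef)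
    (hoff : ∀ i j, i ≠ j → A i j ≤ 0) (x : U → ℝ) (hx : ∀ i, 0 ≤ (A *ᵥ x) i) (i : U) :
    0 ≤ x i := by
  set m : U → ℝ := fun i => max (-x i) 0 with hm
  have hm0 : m = 0 := by
    by_contra hne
    have hpos := hA.dotProduct_mulVec_pos hne
    have h1 : 0 ≤ m ⬝ᵥ (A *ᵥ x) :=
      Finset.sum_nonneg fun i _ => mul_nonneg (le_max_right _ _) (hx i)
    have h2 : m ⬝ᵥ (A *ᵥ (x + m)) ≤ 0 := by
      simp only [dotProduct, mulVec, Finset.mul_sum]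
      refine Finset.sum_nonpos fun i _ => Finset.sum_nonpos fun j _ => ?_
      have hxm : ∀ k, 0 ≤ x k + m k := fun k => by
        have := le_max_left (-x k) 0; simp only [hm]; linarith
      by_cases hij : i = j
      · subst hij
        have : m i * (x i + m i) = 0 := by
          simp only [hm]
          rcases le_total (x i) 0 with h | h
          · rw [max_eq_left (by linarith)]; ring
          · rw [max_eq_right (by linarith)]; ring
        simp only [Pi.add_apply]
        exact le_of_eq (by linear_combination A i i * this)
      · have h3 : 0 ≤ m i := le_max_right _ _
        have := mul_nonneg h3 (hxm j)
        have h4 := hoff i j hij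
        simp only [Pi.add_apply]
        nlinarith
    rw [mulVec_add, dotProduct_add] at h2
    simp only [star_trivial] at hpos
    linarith
  have := congrFun hm0 i
  simp only [hm, Pi.zero_apply] at this
  have h5 := le_max_left (-x i) 0
  linarith

lemma posDef_iff_psd_det {U : Type*} [Fintype U] [DecidableEq U] (A : Matrix U U ℝ) :
    A.PosDef ↔ A.PosSemidef ∧ A.det ≠ 0 :=
  ⟨fun h => ⟨h.posSemidef, h.det_pos.ne'⟩, fun h => h.1.posDef_iff_det_ne_zero.2 h.2⟩

lemma Hmat_apply_cont {U : Type*} [Fintype U] [DecidableEq U] (W : Matrix U U ℝ) :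
    Continuous (Hmat W) := by
  unfold Hmat
  fun_prop

lemma measurableSet_pd {U : Type*} [Fintype U] [DecidableEq U] (W : Matrix U U ℝ) :
    MeasurableSet {β : U → ℝ | (Hmat W β).PosDef} := by
  have hc := Hmat_apply_cont W
  have : {β : U → ℝ | (Hmat W β).PosDef} = ({β : U → ℝ | (Hmat W β)ᴴ = Hmat W β} ∩
      ⋂ x : U → ℝ, {β | 0 ≤ star x ⬝ᵥ (Hmat W β *ᵥ x)}) ∩ {β | (Hmat W β).det = 0}ᶜ := by
    ext β
    simp only [Set.mem_ofPred_eq, posDef_iff_psd_det, posSemidef_iff_dotProduct_mulVec,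
      Set.mem_inter_iff, Set.mem_iInter, Set.mem_compl_iff, Matrix.IsHermitian, ne_eq]
  rw [this]
  refine ((IsClosed.inter ?_ ?_).measurableSet).inter (IsClosed.measurableSet ?_).compl
  · exact isClosed_eq (by fun_prop) hc
  · refine isClosed_iInter fun x => isClosed_le continuous_const ?_
    fun_prop
  · exact isClosed_eq (by fun_prop) continuous_const

lemma measurable_nuDens {U : Type*} [Fintype U] [DecidableEq U] (W : Matrix U U ℝ) (η : U → ℝ) :
    Measurable (nuDens W η) := by
  have hc := Hmat_apply_cont W
  unfold nuDens
  refine Measurable.indicator ?_ (measurableSet_pd W)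
  have h1 : Measurable fun β : U → ℝ => (Hmat W β).det := Continuous.measurable (by fun_prop)
  have h2 : Measurable fun β : U → ℝ => (1 : U → ℝ) ⬝ᵥ (Hmat W β).mulVec 1 :=
    Continuous.measurable (by fun_prop)
  have h3 : Measurable fun β : U → ℝ => η ⬝ᵥ (Hmat W β)⁻¹.mulVec η := by
    simp only [Matrix.inv_def, Ring.inverse_eq_inv', smul_mulVec, dotProduct_smul, smul_eq_mul]
    have h4 : Measurable fun β : U → ℝ => η ⬝ᵥ (Hmat W β).adjugate.mulVec η :=
      Continuous.measurable (by fun_prop)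
    fun_prop
  fun_prop

/-- One-point extension of a matrix. -/
def ext1 {U : Type*} (A : Matrix U U ℝ) (w : U → ℝ) (d : ℝ) : Matrix (U ⊕ Unit) (U ⊕ Unit) ℝ :=
  fromBlocks A (replicateCol Unit (-w)) (replicateRow Unit (-w)) (Matrix.of fun _ _ => d)

section ext1
variable {U : Type*} [Fintype U] [DecidableEq U] (A : Matrix U U ℝ) (w : U → ℝ) (d : ℝ)

lemma ext1_schur : (Matrix.of fun _ _ => d : Matrix Unit Unit ℝ) -
    replicateRow Unit (-w) * A⁻¹ * replicateCol Unit (-w) =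
    Matrix.of fun _ _ => d - w ⬝ᵥ A⁻¹ *ᵥ w := by
  ext i j
  rw [Matrix.mul_assoc]
  simp [Matrix.mul_apply, dotProduct, mulVec]

lemma ext1_det (hA : A.PosDef) : (ext1 A w d).det = A.det * (d - w ⬝ᵥ A⁻¹ *ᵥ w) := by
  have := hA.isUnit.invertible
  rw [ext1, det_fromBlocks₁₁, invOf_eq_nonsing_inv, ext1_schur]
  simp

lemma ext1_posDef (hA : A.PosDef) : (ext1 A w d).PosDef ↔ 0 < d - w ⬝ᵥ A⁻¹ *ᵥ w := by
  constructor
  · intro h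
    have := h.det_pos
    rw [ext1_det A w d hA] at this
    exact (pos_iff_pos_of_mul_pos this).1 hA.det_pos
  · intro h
    have := hA.isUnit.invertible
    rw [posDef_iff_psd_det, ext1_det A w d hA]
    refine ⟨?_, (mul_pos hA.det_pos h).ne'⟩
    have key := PosDef.fromBlocks₁₁ (replicateCol Unit (-w))
      (Matrix.of fun _ _ => d : Matrix Unit Unit ℝ) hA
    have e : (replicateCol Unit (-w))ᴴ = replicateRow Unit (-w) := by ext; simp
    rw [e, ext1_schur] at key
    refine key.2 ?_
    refine PosSemidef.of_dotProduct_mulVec_nonneg (by ext; simp) fun x => ?_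
    have e2 : star x ⬝ᵥ (Matrix.of fun _ _ => d - w ⬝ᵥ A⁻¹ *ᵥ w : Matrix Unit Unit ℝ) *ᵥ x =
        (d - w ⬝ᵥ A⁻¹ *ᵥ w) * (x () * x ()) := by
      generalize d - w ⬝ᵥ A⁻¹ *ᵥ w = t
      simp [dotProduct, mulVec]
      ring
    rw [e2]
    exact mul_nonneg h.le (mul_self_nonneg _)

lemma ext1_sub (h : (ext1 A w d).PosDef) : A.PosDef := by
  have := h.submatrix (e := Sum.inl) Sum.inl_injective
  exact this

lemma ext1_quad_one : (1 : U ⊕ Unit → ℝ) ⬝ᵥ (ext1 A w d) *ᵥ 1 =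
    (1 : U → ℝ) ⬝ᵥ A *ᵥ 1 - 2 * (w ⬝ᵥ 1) + d := by
  simp [ext1, dotProduct, mulVec, Fintype.sum_sum_type, Finset.sum_add_distrib]
  ring

lemma ext1_quad_inv (hA : A.PosDef) (hs : 0 < d - w ⬝ᵥ A⁻¹ *ᵥ w) (η : U ⊕ Unit → ℝ) :
    η ⬝ᵥ (ext1 A w d)⁻¹ *ᵥ η = (η ∘ Sum.inl) ⬝ᵥ A⁻¹ *ᵥ (η ∘ Sum.inl) +
      (η (Sum.inr ()) + w ⬝ᵥ A⁻¹ *ᵥ (η ∘ Sum.inl)) ^ 2 / (d - w ⬝ᵥ A⁻¹ *ᵥ w) := by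
  set s := d - w ⬝ᵥ A⁻¹ *ᵥ w with hsdef
  set e := η ∘ Sum.inl with he
  set c := η (Sum.inr ()) + w ⬝ᵥ A⁻¹ *ᵥ e with hc
  have hu : IsUnit A.det := hA.det_pos.ne'.isUnit
  have hpd := (ext1_posDef A w d hA).2 hs
  have hu' : IsUnit (ext1 A w d).det := hpd.det_pos.ne'.isUnit
  set x : U ⊕ Unit → ℝ := Sum.elim (A⁻¹ *ᵥ e + (c / s) • (A⁻¹ *ᵥ w)) (fun _ => c / s) with hx
  have hsol : (ext1 A w d) *ᵥ x = η := by
    rw [ext1, hx, fromBlocks_mulVec]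
    ext i
    rcases i with i | i
    · simp only [Sum.elim_comp_inl, Sum.elim_comp_inr, Sum.elim_inl, mulVec_add, mulVec_smul,
        mulVec_mulVec, Matrix.mul_nonsing_inv _ hu, one_mulVec, Pi.add_apply]
      simp [mulVec, dotProduct, he]
      ring
    · simp only [Sum.elim_comp_inl, Sum.elim_comp_inr, Sum.elim_inr, Pi.add_apply]
      have h1 : (replicateRow Unit (-w) *ᵥ (A⁻¹ *ᵥ e + (c / s) • (A⁻¹ *ᵥ w))) i =
          -(w ⬝ᵥ A⁻¹ *ᵥ e) - c / s * (w ⬝ᵥ A⁻¹ *ᵥ w) := by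
        change (-w) ⬝ᵥ _ = _
        rw [neg_dotProduct, dotProduct_add, dotProduct_smul, smul_eq_mul]; ring
      have h2 : ((Matrix.of fun _ _ => d : Matrix Unit Unit ℝ) *ᵥ fun _ => c / s) i =
          d * (c / s) := by simp [mulVec, dotProduct]
      rw [h1, h2]
      have h3 : c / s * s = c := div_mul_cancel₀ _ hs.ne'
      have h4 : d = s + w ⬝ᵥ A⁻¹ *ᵥ w := by rw [hsdef]; ring
      rw [h4]
      have h5 : η (Sum.inr i) = c - w ⬝ᵥ A⁻¹ *ᵥ e := by rw [hc]; ring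
      rw [h5]
      linear_combination h3
  have hinv : (ext1 A w d)⁻¹ *ᵥ η = x := by
    rw [← hsol, mulVec_mulVec, Matrix.nonsing_inv_mul _ hu', one_mulVec]
  have hsymm : e ⬝ᵥ A⁻¹ *ᵥ w = w ⬝ᵥ A⁻¹ *ᵥ e := by
    rw [dotProduct_mulVec, ← mulVec_transpose, dotProduct_comm]
    have : (A⁻¹)ᵀ = A⁻¹ := by simpa using hA.inv.isHermitian.eq
    rw [this]
  rw [hinv]
  have : η ⬝ᵥ x = e ⬝ᵥ (A⁻¹ *ᵥ e + (c / s) • (A⁻¹ *ᵥ w)) + η (Sum.inr ()) * (c / s) := by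
    simp [dotProduct, Fintype.sum_sum_type, hx, he]
  rw [this, dotProduct_add, dotProduct_smul, smul_eq_mul, hsymm]
  have h5 : η (Sum.inr ()) = c - w ⬝ᵥ A⁻¹ *ᵥ e := by rw [hc]; ring
  rw [h5]
  ring

end ext1

lemma Hmat_apply {V : Type*} [Fintype V] [DecidableEq V] (W : Matrix V V ℝ) (β : V → ℝ) (i j : V) :
    Hmat W β i j = (if i = j then 2 * β i else 0) - W i j := by
  rw [Hmat, Matrix.sub_apply, Matrix.smul_apply, Matrix.diagonal_apply]
  split_ifs <;> simp

section step
variable {U : Type*} [Fintype U] [DecidableEq U]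

lemma Hmat_ext1 (W : Matrix (U ⊕ Unit) (U ⊕ Unit) ℝ) (hsymm : W.IsSymm) (hdiag : ∀ i, W i i = 0)
    (β : U → ℝ) (b : ℝ) :
    Hmat W (Sum.elim β (fun _ => b)) = ext1 (Hmat (W.submatrix Sum.inl Sum.inl) β)
      (fun i => W (Sum.inl i) (Sum.inr ())) (2 * b) := by
  ext i j
  rcases i with i | i <;> rcases j with j | j
  · by_cases h : i = j
    · subst h; simp [Hmat_apply, ext1]
    · simp [Hmat_apply, ext1, h]
  · simp [Hmat_apply, ext1]
  · simp [Hmat_apply, ext1, hsymm.apply]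
  · simp [Hmat_apply, ext1, hdiag]

lemma nuDens_ext (W : Matrix (U ⊕ Unit) (U ⊕ Unit) ℝ) (hsymm : W.IsSymm)
    (hdiag : ∀ i, W i i = 0) (η : U ⊕ Unit → ℝ) (β : U → ℝ) (b : ℝ)
    (A : Matrix U U ℝ) (hAdef : A = Hmat (W.submatrix Sum.inl Sum.inl) β) (hA : A.PosDef)
    (w : U → ℝ) (hw : w = fun i => W (Sum.inl i) (Sum.inr ())) (q c : ℝ)
    (hq : q = w ⬝ᵥ A⁻¹ *ᵥ w) (hc : c = η (Sum.inr ()) + w ⬝ᵥ A⁻¹ *ᵥ (η ∘ Sum.inl)) :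
    nuDens W η (Sum.elim β (fun _ => b)) =
      nuDens (W.submatrix Sum.inl Sum.inl) (η ∘ Sum.inl + w) β *
      Set.indicator {b : ℝ | 0 < 2 * b - q} (fun b => ENNReal.ofReal
      ((2 / Real.pi) ^ ((1:ℝ) / 2) * (Real.exp (-(1/2) * ((2 * b - q) + c ^ 2 / (2 * b - q)) + c)
        / √(2 * b - q)))) b := by
  unfold nuDens
  have hH := Hmat_ext1 W hsymm hdiag β b
  rw [← hAdef, ← hw] at hH
  have hmem2 : β ∈ {β | (Hmat (W.submatrix Sum.inl Sum.inl) β).PosDef} := by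
    change (Hmat (W.submatrix Sum.inl Sum.inl) β).PosDef
    rwa [← hAdef]
  rw [Set.indicator_of_mem hmem2]
  by_cases hs : 0 < 2 * b - q
  · have hs' : 0 < 2 * b - w ⬝ᵥ A⁻¹ *ᵥ w := by rwa [← hq]
    have hmem : Sum.elim β (fun _ => b) ∈ {β | (Hmat W β).PosDef} := by
      change (Hmat W _).PosDef
      rw [hH]; exact (ext1_posDef A w _ hA).2 hs'
    have hmem3 : b ∈ {b : ℝ | 0 < 2 * b - q} := hs
    rw [Set.indicator_of_mem hmem, Set.indicator_of_mem hmem3, hH, ← hAdef,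
      ← ENNReal.ofReal_mul (by positivity), ext1_quad_one, ext1_quad_inv A w _ hA hs',
      ext1_det A w _ hA, ← hq, ← hc]
    congr 1
    have hsymm' : (η ∘ Sum.inl) ⬝ᵥ A⁻¹ *ᵥ w = w ⬝ᵥ A⁻¹ *ᵥ (η ∘ Sum.inl) := by
      rw [dotProduct_mulVec, ← mulVec_transpose, dotProduct_comm]
      have : (A⁻¹)ᵀ = A⁻¹ := by simpa using hA.inv.isHermitian.eq
      rw [this]
    have hη1 : η ⬝ᵥ (1 : U ⊕ Unit → ℝ) = (η ∘ Sum.inl) ⬝ᵥ (1 : U → ℝ) + η (Sum.inr ()) := by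
      simp [dotProduct, Fintype.sum_sum_type]
    have hcard : (2 / Real.pi) ^ ((Fintype.card (U ⊕ Unit) : ℝ) / 2) =
        (2 / Real.pi) ^ ((Fintype.card U : ℝ) / 2) * (2 / Real.pi) ^ ((1:ℝ) / 2) := by
      rw [← Real.rpow_add (by positivity)]
      congr 1
      simp [Fintype.card_sum]; ring
    rw [hcard, Real.sqrt_mul hA.det_pos.le, hη1, mulVec_add, dotProduct_add, add_dotProduct,
      add_dotProduct, add_dotProduct, hsymm', ← hq]
    have hexp : -(1 / 2) * ((1 : U → ℝ) ⬝ᵥ A *ᵥ 1 - 2 * (w ⬝ᵥ 1) + 2 * b +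
        ((η ∘ Sum.inl) ⬝ᵥ A⁻¹ *ᵥ (η ∘ Sum.inl) + c ^ 2 / (2 * b - q))) +
        ((η ∘ Sum.inl) ⬝ᵥ 1 + η (Sum.inr ())) =
      (-(1 / 2) * ((1 : U → ℝ) ⬝ᵥ A *ᵥ 1 + ((η ∘ Sum.inl) ⬝ᵥ A⁻¹ *ᵥ (η ∘ Sum.inl) +
        w ⬝ᵥ A⁻¹ *ᵥ (η ∘ Sum.inl) + (w ⬝ᵥ A⁻¹ *ᵥ (η ∘ Sum.inl) + q))) +
        ((η ∘ Sum.inl) ⬝ᵥ 1 + w ⬝ᵥ 1)) +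
      (-(1/2) * ((2 * b - q) + c ^ 2 / (2 * b - q)) + c) := by
      linear_combination -hc
    rw [hexp, Real.exp_add]
    have h1 : 0 < √A.det := Real.sqrt_pos.2 hA.det_pos
    have h2 : 0 < √(2 * b - q) := Real.sqrt_pos.2 hs
    generalize Real.exp _ = E1
    generalize Real.exp _ = E2
    generalize √A.det = r1 at *
    generalize √(2 * b - q) = r2 at *
    generalize (2 / Real.pi) ^ ((1:ℝ) / 2) = p1
    generalize (2 / Real.pi) ^ ((Fintype.card U : ℝ) / 2) = p2
    field_simp
  · have hmem : Sum.elim β (fun _ => b) ∉ {β | (Hmat W β).PosDef} := by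
      change ¬ (Hmat W _).PosDef
      rw [hH, ext1_posDef A w _ hA, ← hq]; exact hs
    have hmem3 : b ∉ {b : ℝ | 0 < 2 * b - q} := hs
    rw [Set.indicator_of_notMem hmem, Set.indicator_of_notMem hmem3, mul_zero]

lemma inner_int (W : Matrix (U ⊕ Unit) (U ⊕ Unit) ℝ) (hsymm : W.IsSymm) (hnn : ∀ i j, 0 ≤ W i j)
    (hdiag : ∀ i, W i i = 0) (η : U ⊕ Unit → ℝ) (hη : ∀ i, 0 ≤ η i) (β : U → ℝ) :
    ∫⁻ b : ℝ, nuDens W η (Sum.elim β (fun _ => b)) =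
      nuDens (W.submatrix Sum.inl Sum.inl)
        (η ∘ Sum.inl + fun i => W (Sum.inl i) (Sum.inr ())) β := by
  by_cases hA : (Hmat (W.submatrix Sum.inl Sum.inl) β).PosDef
  · simp_rw [nuDens_ext W hsymm hdiag η β _ _ rfl hA _ rfl _ _ rfl rfl]
    have hm : MeasurableSet {b : ℝ | 0 < 2 * b - (fun i => W (Sum.inl i) (Sum.inr ())) ⬝ᵥ
        (Hmat (W.submatrix Sum.inl Sum.inl) β)⁻¹ *ᵥ (fun i => W (Sum.inl i) (Sum.inr ()))} :=
      measurableSet_lt measurable_const (by fun_prop)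
    rw [lintegral_const_mul _ (Measurable.indicator (by fun_prop) hm), oneD_shift, mul_one]
    refine add_nonneg (hη _) (Finset.sum_nonneg fun i _ => mul_nonneg (hnn _ _) ?_)
    refine mmatrix_nonneg _ hA ?_ _ ?_ i
    · intro i j hij
      simp [Hmat_apply, hij, hnn]
    · intro i
      rw [mulVec_mulVec, Matrix.mul_nonsing_inv _ hA.det_pos.ne'.isUnit, one_mulVec]
      exact hη _
  · have h0 : nuDens (W.submatrix Sum.inl Sum.inl)
        (η ∘ Sum.inl + fun i => W (Sum.inl i) (Sum.inr ())) β = 0 :=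
      Set.indicator_of_notMem (by exact hA) _
    rw [h0]
    have : ∀ b : ℝ, nuDens W η (Sum.elim β (fun _ => b)) = 0 := fun b => by
      refine Set.indicator_of_notMem ?_ _
      change ¬ (Hmat W _).PosDef
      rw [Hmat_ext1 W hsymm hdiag]
      exact fun h => hA (ext1_sub _ _ _ h)
    simp [this]

end step

/-- The total mass is one, for all admissible weights on `V`. -/
def MassOne (V : Type*) [Fintype V] : Prop :=
  ∀ (_ : DecidableEq V) (W : Matrix V V ℝ) (_ : W.IsSymm) (_ : ∀ i j, 0 ≤ W i j)
    (_ : ∀ i, W i i = 0) (η : V → ℝ) (_ : ∀ i, 0 ≤ η i), ∫⁻ β, nuDens W η β = 1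

lemma massOne_sum (U : Type*) [Fintype U] (h : MassOne U) : MassOne (U ⊕ Unit) := by
  classical
  intro inst W hsymm hnn hdiag η hη
  have : inst = instDecidableEqSum := Subsingleton.elim _ _
  subst this
  have hmp := volume_measurePreserving_sumPiEquivProdPi_symm (fun _ : U ⊕ Unit => ℝ)
  have hmeas := measurable_nuDens W η
  rw [← hmp.lintegral_comp hmeas, Measure.volume_eq_prod,
    lintegral_prod (fun a => nuDens W η
      ((MeasurableEquiv.sumPiEquivProdPi fun _ : U ⊕ Unit => ℝ).symm a))
      (hmeas.comp (MeasurableEquiv.measurable _)).aemeasurable]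
  have hin : ∀ β : U → ℝ, ∫⁻ y : Unit → ℝ, nuDens W η
      ((MeasurableEquiv.sumPiEquivProdPi fun _ : U ⊕ Unit => ℝ).symm (β, y)) =
      nuDens (W.submatrix Sum.inl Sum.inl)
        (η ∘ Sum.inl + fun i => W (Sum.inl i) (Sum.inr ())) β := fun β => by
    rw [← inner_int W hsymm hnn hdiag η hη β]
    have hu := volume_preserving_funUnique Unit ℝ
    rw [← hu.lintegral_comp_emb (MeasurableEquiv.measurableEmbedding _)]
    refine lintegral_congr fun y => ?_
    congr 1
  simp_rw [hin]
  exact h _ _ (hsymm.submatrix _) (fun _ _ => hnn _ _) (fun _ => hdiag _) _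
    (fun i => add_nonneg (hη _) (hnn _ _))

lemma nuDens_reindex {V V' : Type*} [Fintype V] [Fintype V'] [DecidableEq V] [DecidableEq V']
    (e : V ≃ V') (W : Matrix V' V' ℝ) (η : V' → ℝ) (β : V' → ℝ) :
    nuDens (W.submatrix e e) (η ∘ e) (β ∘ e) = nuDens W η β := by
  have hH : Hmat (W.submatrix e e) (β ∘ e) = (Hmat W β).submatrix e e := by
    ext i j
    simp [Hmat_apply]
  have hpd : ((Hmat W β).submatrix e e).PosDef ↔ (Hmat W β).PosDef := by
    constructor
    · intro h
      simpa using h.submatrix e.symm.injective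
    · intro h; exact h.submatrix e.injective
  have hdot : ∀ x y : V' → ℝ, (x ∘ e) ⬝ᵥ (y ∘ e) = x ⬝ᵥ y := fun x y => by
    simp only [dotProduct, Function.comp_apply]
    exact e.sum_comp fun i => x i * y i
  have hmv : ∀ (M : Matrix V' V' ℝ) (y : V' → ℝ), M.submatrix e e *ᵥ (y ∘ e) = (M *ᵥ y) ∘ e :=
    fun M y => by
      ext i
      simp only [mulVec, dotProduct, Function.comp_apply, submatrix_apply]
      exact e.sum_comp fun j => M (e i) j * y j
  have h1 : (1 : V → ℝ) = (1 : V' → ℝ) ∘ e := rfl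
  unfold nuDens
  by_cases h : (Hmat W β).PosDef
  · rw [Set.indicator_of_mem (by change (Hmat _ _).PosDef; rw [hH]; exact hpd.2 h),
      Set.indicator_of_mem (by exact h), hH, inv_submatrix_equiv, det_submatrix_equiv_self, h1,
      hmv, hmv, hdot, hdot, hdot, Fintype.card_congr e]
  · rw [Set.indicator_of_notMem (by change ¬ (Hmat _ _).PosDef; rw [hH]; exact fun h' => h (hpd.1 h')),
      Set.indicator_of_notMem (by exact h)]

lemma massOne_equiv {V V' : Type*} [Fintype V] [Fintype V'] (e : V ≃ V') (h : MassOne V) :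
    MassOne V' := by
  classical
  intro inst W hsymm hnn hdiag η hη
  rw [← h inferInstance (W.submatrix e e) (hsymm.submatrix _) (fun _ _ => hnn _ _) (fun _ => hdiag _) (η ∘ e)
    (fun _ => hη _)]
  have hmp := volume_measurePreserving_piCongrLeft (fun _ : V' => ℝ) e
  rw [← hmp.lintegral_comp (measurable_nuDens W η)]
  refine lintegral_congr fun β => ?_
  rw [← nuDens_reindex e]
  congr 1
  ext i
  exact Equiv.piCongrLeft_apply_apply (fun _ : V' => ℝ) e β i

lemma massOne_empty (V : Type*) [Fintype V] [IsEmpty V] : MassOne V := by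
  intro inst W _ _ _ η _
  have h : ∀ β, nuDens W η β = 1 := fun β => by
    unfold nuDens
    have hp : (Hmat W β).PosDef := by
      rw [posDef_iff_dotProduct_mulVec]
      exact ⟨Subsingleton.elim _ _, fun x hx => absurd (Subsingleton.elim _ _) hx⟩
    rw [Set.indicator_of_mem (by exact hp)]
    simp [dotProduct]
  simp_rw [h]
  rw [lintegral_one, volume_pi, Measure.pi_of_empty]
  simp

lemma massOne_all (V : Type*) [Fintype V] : MassOne V := by
  refine Fintype.induction_empty_option (P := fun V _ => MassOne V) ?_ ?_ ?_ V
  · intro α β _ e h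
    letI := Fintype.ofEquiv β e.symm
    exact massOne_equiv (V := α) e h
  · exact massOne_empty _
  · intro α _ h
    exact massOne_equiv (Equiv.optionEquivSumPUnit α).symm (massOne_sum α h)

theorem stmt0 {V : Type*} [Fintype V] [DecidableEq V] [Nonempty V]
    (W : Matrix V V ℝ) (hsymm : W.IsSymm) (hnn : ∀ i j, 0 ≤ W i j)
    (hdiag : ∀ i, W i i = 0) (hconn : (graphOf W).Connected)
    (η : V → ℝ) (hη : ∀ i, 0 ≤ η i) :
    IsProbabilityMeasure (nuMeas W η) := by
  refine ⟨?_⟩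
  rw [nuMeas, withDensity_apply _ MeasurableSet.univ, Measure.restrict_univ]
  exact massOne_all V _ W hsymm hnn hdiag η hη

end
end

section
/- For every λ ∈ [0,∞)^V, ∫ exp(−⟨λ,β⟩) ν_V^{W,η}(dβ) = exp( −Σ_{i∈V} η_i(√(1+λ_i) − 1) − (1/2)·Σ_{i≠j} W_{ij}(√((1+λ_i)(1+λ_j)) − 1) ) · ∏_{i∈V} (1+λ_i)^{−1/2}. -/
open MeasureTheory Matrix

noncomputable section

lemma aux_gauss : ∫⁻ u : ℝ, ENNReal.ofReal (Real.exp (-(1/2) * u^2)) = ENNReal.ofReal (Real.sqrt (2*Real.pi)) := by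
  rw [← ofReal_integral_eq_lintegral_ofReal, integral_gaussian]
  · congr 2; ring
  · exact integrable_exp_neg_mul_sq (by norm_num)
  · exact Filter.Eventually.of_forall fun x => (Real.exp_pos _).le

lemma aux_K0 (a : ℝ) (ha : 0 < a) :
    ∫⁻ x in Set.Ioi (0:ℝ), ENNReal.ofReal (Real.exp (-(1/2) * (a*x)^2)) = ENNReal.ofReal (Real.sqrt (Real.pi/2) / a) := by
  have h : ∀ x : ℝ, -(1/2) * (a*x)^2 = -(a^2/2) * x^2 := fun x => by ring
  simp_rw [h]
  rw [← ofReal_integral_eq_lintegral_ofReal, integral_gaussian_Ioi]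
  · congr 1
    rw [show Real.pi / (a^2/2) = (Real.pi/2) * (2/a)^2 by field_simp, Real.sqrt_mul (by positivity),
      Real.sqrt_sq (by positivity)]
    field_simp
  · exact (integrable_exp_neg_mul_sq (by positivity)).integrableOn
  · exact Filter.Eventually.of_forall fun x => (Real.exp_pos _).le

lemma aux_K1 (a c : ℝ) (ha : 0 < a) (hc : 0 < c) :
    ∫⁻ x in Set.Ioi (0:ℝ), ENNReal.ofReal (Real.exp (-(1/2) * (a*x - c/x)^2)) = ENNReal.ofReal (Real.sqrt (Real.pi/2) / a) := by
  set f : ℝ → ENNReal := fun x => ENNReal.ofReal (Real.exp (-(1/2) * (a*x - c/x)^2)) with hf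
  have hfm : Measurable f := by fun_prop
  set K := ∫⁻ x in Set.Ioi (0:ℝ), f x with hK
  have hA : ENNReal.ofReal (Real.sqrt (2*Real.pi)) = ∫⁻ x in Set.Ioi (0:ℝ), ENNReal.ofReal |a + c/x^2| * f x := by
    have himg : (fun x : ℝ => a*x - c/x) '' Set.Ioi 0 = Set.univ := by
      ext u
      simp only [Set.mem_image, Set.mem_Ioi, Set.mem_univ, iff_true]
      have hlt : |u| < Real.sqrt (u^2+4*a*c) := by
        rw [← Real.sqrt_sq_eq_abs]; exact Real.sqrt_lt_sqrt (sq_nonneg _) (by nlinarith [mul_pos ha hc])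
      have hp : 0 < u + Real.sqrt (u^2+4*a*c) := by linarith [neg_abs_le u]
      have hs : Real.sqrt (u^2+4*a*c) ^ 2 = u^2+4*a*c := Real.sq_sqrt (by nlinarith [mul_pos ha hc, sq_nonneg u])
      refine ⟨(u + Real.sqrt (u^2+4*a*c))/(2*a), by positivity, ?_⟩
      set s := Real.sqrt (u^2+4*a*c)
      field_simp
      nlinarith
    rw [← aux_gauss, ← setLIntegral_univ, ← himg]
    rw [lintegral_image_eq_lintegral_abs_deriv_mul (f' := fun x => a + c/x^2) measurableSet_Ioi]
    · intro x hx
      have hx' : x ≠ 0 := ne_of_gt hx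
      apply HasDerivAt.hasDerivWithinAt
      have h1 := ((hasDerivAt_id x).const_mul a).sub ((hasDerivAt_inv hx').const_mul c)
      have e1 : (fun x : ℝ => a*x - c/x) = (fun y => a * id y) - fun y => c * y⁻¹ := by
        funext z; simp [div_eq_mul_inv]
      rw [e1]
      convert h1 using 1
      ring
    · intro x hx y hy hxy
      simp only [Set.mem_Ioi] at hx hy
      simp only at hxy
      have : (x - y) * (a + c/(x*y)) = 0 := by
        have : (x - y) * (a + c/(x*y)) = (a*x - c/x) - (a*y - c/y) := by field_simp; ring
        rw [this, hxy, sub_self]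
      rcases mul_eq_zero.mp this with h | h
      · linarith
      · have : 0 < a + c/(x*y) := by positivity
        linarith
  have hB : K = ∫⁻ x in Set.Ioi (0:ℝ), ENNReal.ofReal |-(c/a/x^2)| * f x := by
    have himg : (fun x : ℝ => c/a/x) '' Set.Ioi 0 = Set.Ioi 0 := by
      ext u
      simp only [Set.mem_image, Set.mem_Ioi]
      constructor
      · rintro ⟨x, hx, rfl⟩; positivity
      · intro hu; exact ⟨c/a/u, by positivity, by field_simp⟩
    rw [hK]
    nth_rewrite 1 [← himg]
    rw [lintegral_image_eq_lintegral_abs_deriv_mul (f' := fun x => -(c/a/x^2)) measurableSet_Ioi]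
    · refine setLIntegral_congr_fun measurableSet_Ioi fun x hx => ?_
      have hx' : x ≠ 0 := ne_of_gt hx
      simp only [hf]
      congr 4
      field_simp
      ring
    · intro x hx
      have hx' : x ≠ 0 := ne_of_gt hx
      apply HasDerivAt.hasDerivWithinAt
      have h1 := ((hasDerivAt_inv hx').const_mul (c/a))
      have e1 : (fun x : ℝ => c/a/x) = (fun y => c/a * y⁻¹) := by
        funext z; simp [div_eq_mul_inv]
      have e2 : -(c/a/x^2) = c / a * -(x ^ 2)⁻¹ := by ring
      rw [e1, e2]
      exact h1
    · intro x hx y hy hxy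
      simp only [Set.mem_Ioi] at hx hy
      simp only at hxy
      field_simp at hxy
      exact hxy.symm
  have hsum : ENNReal.ofReal (Real.sqrt (2*Real.pi)) = ENNReal.ofReal (2*a) * K := by
    have e2 : ENNReal.ofReal (2*a) * K = ENNReal.ofReal a * K + ENNReal.ofReal a * K := by
      rw [← add_mul, ← ENNReal.ofReal_add ha.le ha.le]; congr 2; ring
    rw [hA, e2]
    nth_rewrite 2 [hB]
    rw [hK, ← lintegral_const_mul _ (by fun_prop), ← lintegral_const_mul _ (by fun_prop),
      ← lintegral_add_left (by fun_prop)]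
    refine setLIntegral_congr_fun measurableSet_Ioi fun x hx => ?_
    have hx' : (0:ℝ) < x := hx
    rw [← mul_assoc, ← add_mul, ← ENNReal.ofReal_mul ha.le, ← ENNReal.ofReal_add ha.le (by positivity),
      abs_neg, abs_of_pos (by positivity), abs_of_pos (by positivity)]
    congr 2
    field_simp
  have h2a : ENNReal.ofReal (2*a) ≠ 0 := by simpa using ha
  rw [← ENNReal.mul_right_inj h2a ENNReal.ofReal_ne_top, ← hsum, ← ENNReal.ofReal_mul (by positivity)]
  congr 1
  rw [show 2*Real.pi = (Real.pi/2) * 2^2 by ring, Real.sqrt_mul (by positivity), Real.sqrt_sq (by positivity)]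
  field_simp

lemma aux_K (a c : ℝ) (ha : 0 < a) (hc : 0 ≤ c) :
    ∫⁻ x in Set.Ioi (0:ℝ), ENNReal.ofReal (Real.exp (-(1/2) * (a^2*x^2 + c^2/x^2))) =
      ENNReal.ofReal (Real.sqrt (Real.pi/2) / a * Real.exp (-(a*c))) := by
  have h : ∀ x ∈ Set.Ioi (0:ℝ), ENNReal.ofReal (Real.exp (-(1/2) * (a^2*x^2 + c^2/x^2))) =
      ENNReal.ofReal (Real.exp (-(1/2) * (a*x - c/x)^2)) * ENNReal.ofReal (Real.exp (-(a*c))) := by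
    intro x hx
    have hx' : x ≠ 0 := ne_of_gt hx
    rw [← ENNReal.ofReal_mul (Real.exp_pos _).le, ← Real.exp_add]
    congr 2
    field_simp
    ring
  rw [setLIntegral_congr_fun measurableSet_Ioi h, lintegral_mul_const _ (by fun_prop),
    ENNReal.ofReal_mul (by positivity)]
  congr 1
  rcases hc.eq_or_lt with rfl | hc
  · simpa using aux_K0 a ha
  · exact aux_K1 a c ha hc

lemma aux_J (a c s : ℝ) (ha : 0 < a) (hc : 0 ≤ c) :
    ∫⁻ b : ℝ, Set.indicator {b : ℝ | 0 < 2*b - s} (fun b => ENNReal.ofReal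
      (Real.exp (-(1/2) * (a^2*(2*b-s) + c^2/(2*b-s))) / Real.sqrt (2*b-s))) b =
      ENNReal.ofReal (Real.sqrt (Real.pi/2) / a * Real.exp (-(a*c))) := by
  rw [← aux_K a c ha hc, lintegral_indicator (measurableSet_lt (by fun_prop) (by fun_prop))]
  have himg : (fun x : ℝ => (x^2+s)/2) '' Set.Ioi 0 = {b : ℝ | 0 < 2*b - s} := by
    ext u
    simp only [Set.mem_image, Set.mem_Ioi, Set.mem_ofPred_eq]
    constructor
    · rintro ⟨x, hx, rfl⟩; nlinarith
    · intro hu; exact ⟨√(2*u-s), by positivity, by rw [Real.sq_sqrt hu.le]; ring⟩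
  rw [← himg, lintegral_image_eq_lintegral_abs_deriv_mul (f' := fun x => x) measurableSet_Ioi]
  · refine setLIntegral_congr_fun measurableSet_Ioi fun x hx => ?_
    have hx' : (0:ℝ) < x := hx
    rw [show 2 * ((x^2+s)/2) - s = x^2 by ring, Real.sqrt_sq hx'.le, abs_of_pos hx',
      ← ENNReal.ofReal_mul hx'.le]
    congr 1
    field_simp
  · intro x hx
    apply HasDerivAt.hasDerivWithinAt
    have h1 := (((hasDerivAt_pow 2 x)).add_const s).div_const 2
    have e2 : ((2:ℕ):ℝ) * x ^ (2 - 1) / 2 = x := by simp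
    rw [e2] at h1
    exact h1
  · intro x hx y hy hxy
    simp only [Set.mem_Ioi] at hx hy
    have : (x - y) * (x+y) = 0 := by linarith
    rcases mul_eq_zero.mp this with h | h <;> linarith

lemma aux_mmatrix {V : Type*} [Fintype V] [DecidableEq V] (M : Matrix V V ℝ) (hM : M.PosDef)
    (hoff : ∀ i j, i ≠ j → M i j ≤ 0) (b : V → ℝ) (hb : ∀ i, 0 ≤ b i) : ∀ i, 0 ≤ (M⁻¹ *ᵥ b) i := by
  set x := M⁻¹ *ᵥ b with hx
  have hMx : M *ᵥ x = b := by
    rw [hx, Matrix.mulVec_mulVec, Matrix.mul_nonsing_inv _ ((Matrix.isUnit_iff_isUnit_det _).mp hM.isUnit),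
      Matrix.one_mulVec]
  set n : V → ℝ := fun i => max (-x i) 0 with hn
  have hn0 : n = 0 := by
    by_contra hne
    have h1 := hM.dotProduct_mulVec_pos hne
    have h2 : n ⬝ᵥ (M *ᵥ n) ≤ - (n ⬝ᵥ (M *ᵥ x)) := by
      simp only [dotProduct, mulVec, Finset.mul_sum, ← Finset.sum_neg_distrib]
      refine Finset.sum_le_sum fun i _ => Finset.sum_le_sum fun j _ => ?_
      by_cases hij : i = j
      · subst hij
        apply le_of_eq
        simp only [hn]
        rcases le_total (-x i) 0 with h | h
        · simp [max_eq_right h]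
        · simp [max_eq_left h]
      · have h3 := hoff i j hij
        have h4 : 0 ≤ n i := le_max_right _ _
        have h5 : -x j ≤ n j := le_max_left _ _
        nlinarith [mul_nonneg h4 (neg_nonneg.mpr h3)]
    have h3 : 0 ≤ n ⬝ᵥ (M *ᵥ x) := by
      rw [hMx]
      exact Finset.sum_nonneg fun i _ => mul_nonneg (le_max_right _ _) (hb i)
    simp only [star_trivial] at h1
    linarith
  intro i
  have : n i = 0 := by rw [hn0]; rfl
  have h5 : -x i ≤ n i := le_max_left _ _
  linarith

/-- Bordered matrix. -/
def blk {V : Type*} (p : ℝ) (w : V → ℝ) (D : Matrix V V ℝ) : Matrix (Unit ⊕ V) (Unit ⊕ V) ℝ :=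
  Matrix.fromBlocks (Matrix.of fun _ _ => p) (Matrix.replicateRow Unit (-w))
    (Matrix.replicateCol Unit (-w)) D

section blk
set_option linter.unusedSectionVars false
variable {V : Type*} [Fintype V] [DecidableEq V] (p : ℝ) (w : V → ℝ) (D : Matrix V V ℝ)

lemma blk_schur : (Matrix.of fun _ _ => p : Matrix Unit Unit ℝ) - Matrix.replicateRow Unit (-w) * D⁻¹ *
    Matrix.replicateCol Unit (-w) = Matrix.diagonal (fun _ => p - w ⬝ᵥ D⁻¹ *ᵥ w) := by
  ext i j
  have hcol : Matrix.replicateRow Unit (-w) * D⁻¹ * Matrix.replicateCol Unit (-w)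
      = Matrix.of fun _ _ => w ⬝ᵥ D⁻¹ *ᵥ w := by
    rw [Matrix.mul_assoc]
    ext i j
    simp only [Matrix.mul_apply, Matrix.replicateRow_apply, Matrix.replicateCol_apply, of_apply, dotProduct, mulVec]
    simp
  rw [hcol]
  simp

lemma blk_det (hD : D.PosDef) : (blk p w D).det = D.det * (p - w ⬝ᵥ D⁻¹ *ᵥ w) := by
  have := hD.isUnit.invertible
  rw [blk, Matrix.det_fromBlocks₂₂, Matrix.invOf_eq_nonsing_inv, blk_schur]
  simp

lemma blk_posDef (hD : D.PosDef) : (blk p w D).PosDef ↔ 0 < p - w ⬝ᵥ D⁻¹ *ᵥ w := by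
  have := hD.isUnit.invertible
  have hps : (blk p w D).PosSemidef ↔ 0 ≤ p - w ⬝ᵥ D⁻¹ *ᵥ w := by
    have hct : Matrix.replicateCol Unit (-w) = (Matrix.replicateRow Unit (-w))ᴴ := by
      ext; simp
    have h1 := Matrix.PosDef.fromBlocks₂₂ (Matrix.of fun _ _ => p : Matrix Unit Unit ℝ) (Matrix.replicateRow Unit (-w)) hD
    rw [← hct, blk_schur] at h1
    rw [blk, h1]
    simp
  constructor
  · intro h
    refine lt_of_le_of_ne (hps.mp h.posSemidef) fun h0 => ?_
    have := h.det_pos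
    rw [blk_det p w D hD, ← h0] at this
    simp at this
  · intro h
    rw [(hps.mpr h.le).posDef_iff_det_ne_zero, blk_det p w D hD]
    exact mul_ne_zero hD.det_pos.ne' h.ne'

lemma blk_mulVec (e : ℝ) (x : V → ℝ) : blk p w D *ᵥ (Sum.elim (fun _ => e) x) =
    Sum.elim (fun _ => p * e - w ⬝ᵥ x) (D *ᵥ x - e • w) := by
  rw [blk, Matrix.fromBlocks_mulVec]
  ext (i | i)
  · simp [mulVec, dotProduct, sub_eq_add_neg]
  · simp [mulVec, dotProduct, sub_eq_add_neg]; ring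

lemma blk_dot (e f : ℝ) (x z : V → ℝ) : (Sum.elim (fun _ => e) x : Unit ⊕ V → ℝ) ⬝ᵥ (Sum.elim (fun _ => f) z)
   = e * f + x ⬝ᵥ z := by
  simp [dotProduct]

lemma blk_inv (hD : D.PosDef) (hy : 0 < p - w ⬝ᵥ D⁻¹ *ᵥ w) (e : ℝ) (x : V → ℝ) :
    (Sum.elim (fun _ => e) x : Unit ⊕ V → ℝ) ⬝ᵥ (blk p w D)⁻¹ *ᵥ (Sum.elim (fun _ => e) x) =
      x ⬝ᵥ D⁻¹ *ᵥ x + (e + w ⬝ᵥ D⁻¹ *ᵥ x)^2 / (p - w ⬝ᵥ D⁻¹ *ᵥ w) := by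
  set y := p - w ⬝ᵥ D⁻¹ *ᵥ w with hydef
  set c := e + w ⬝ᵥ D⁻¹ *ᵥ x with hc
  have hDD : D * D⁻¹ = 1 := Matrix.mul_nonsing_inv _ ((Matrix.isUnit_iff_isUnit_det _).mp hD.isUnit)
  have hB := (blk_posDef p w D hD).mpr hy
  have hBB : (blk p w D)⁻¹ * blk p w D = 1 :=
    Matrix.nonsing_inv_mul _ ((Matrix.isUnit_iff_isUnit_det _).mp hB.isUnit)
  have hsol : blk p w D *ᵥ (Sum.elim (fun _ => c / y) (D⁻¹ *ᵥ (x + (c/y) • w))) = Sum.elim (fun _ => e) x := by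
    rw [blk_mulVec]
    have h1 : p * (c/y) - w ⬝ᵥ D⁻¹ *ᵥ (x + (c/y) • w) = e := by
      rw [Matrix.mulVec_add, Matrix.mulVec_smul, dotProduct_add, dotProduct_smul, smul_eq_mul]
      have : p = y + w ⬝ᵥ D⁻¹ *ᵥ w := by rw [hydef]; ring
      have h2 : w ⬝ᵥ D⁻¹ *ᵥ x = c - e := by rw [hc]; ring
      rw [this, h2]
      field_simp
      ring
    rw [h1, Matrix.mulVec_mulVec, hDD, Matrix.one_mulVec]
    simp
  have hinv : (blk p w D)⁻¹ *ᵥ (Sum.elim (fun _ => e) x) = Sum.elim (fun _ => c / y) (D⁻¹ *ᵥ (x + (c/y) • w)) := by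
    rw [← hsol, Matrix.mulVec_mulVec, hBB, Matrix.one_mulVec]
  have hsym : x ⬝ᵥ D⁻¹ *ᵥ w = w ⬝ᵥ D⁻¹ *ᵥ x := by
    have ht : (D⁻¹)ᵀ = D⁻¹ := by
      have := hD.inv.isHermitian
      simpa [Matrix.IsHermitian] using this
    rw [dotProduct_mulVec, ← mulVec_transpose, ht, dotProduct_comm]
  rw [hinv, blk_dot, Matrix.mulVec_add, Matrix.mulVec_smul, dotProduct_add, dotProduct_smul, smul_eq_mul, hsym]
  have h2 : w ⬝ᵥ D⁻¹ *ᵥ x = c - e := by rw [hc]; ring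
  rw [h2]
  field_simp
  ring

end blk

section main
set_option linter.unusedSectionVars false

/-- The integrand. -/
def Ffun {V : Type*} [Fintype V] [DecidableEq V] (W : Matrix V V ℝ) (η θ : V → ℝ) (β : V → ℝ) : ℝ :=
  Real.exp (-(1/2) * (θ ⬝ᵥ (Hmat W β) *ᵥ θ + η ⬝ᵥ (Hmat W β)⁻¹ *ᵥ η)) / Real.sqrt (Hmat W β).det

/-- The integrand restricted to the domain. -/
def Find {V : Type*} [Fintype V] [DecidableEq V] (W : Matrix V V ℝ) (η θ : V → ℝ) (β : V → ℝ) : ENNReal :=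
  Set.indicator {β : V → ℝ | (Hmat W β).PosDef} (fun β => ENNReal.ofReal (Ffun W η θ β)) β

/-- The main integral identity. -/
def MainP (V : Type*) [Fintype V] [DecidableEq V] : Prop :=
  ∀ W : Matrix V V ℝ, W.IsSymm → (∀ i j, 0 ≤ W i j) → ∀ η θ : V → ℝ, (∀ i, 0 ≤ η i) → (∀ i, 0 < θ i) →
    ∫⁻ β, Find W η θ β = ENNReal.ofReal ((∏ i, Real.sqrt (Real.pi/2) / θ i) * Real.exp (-(η ⬝ᵥ θ)))

variable {V : Type*} [Fintype V] [DecidableEq V]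

lemma Hmat_cont (W : Matrix V V ℝ) : Continuous (fun β => Hmat W β) := by
  unfold Hmat
  fun_prop

lemma Hmat_eq (W : Matrix V V ℝ) (β : V → ℝ) : Hmat W β = Matrix.diagonal (fun i => 2 * β i) - W := by
  rw [Hmat, ← Matrix.diagonal_smul]
  congr 2
  ext i; simp

lemma Hmat_herm (W : Matrix V V ℝ) (hW : W.IsSymm) (β : V → ℝ) : (Hmat W β).IsHermitian := by
  have : Wᵀ = W := hW
  simp [Matrix.IsHermitian, Hmat_eq, this]

lemma dom_meas (W : Matrix V V ℝ) (hW : W.IsSymm) : MeasurableSet {β : V → ℝ | (Hmat W β).PosDef} := by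
  have : {β : V → ℝ | (Hmat W β).PosDef} = (⋂ x : V → ℝ, {β : V → ℝ | 0 ≤ x ⬝ᵥ (Hmat W β) *ᵥ x}) ∩
      {β | (Hmat W β).det ≠ 0} := by
    ext β
    simp only [Set.mem_ofPred_eq, Set.mem_inter_iff, Set.mem_iInter]
    constructor
    · intro h
      exact ⟨fun x => by simpa using h.posSemidef.dotProduct_mulVec_nonneg x, h.det_pos.ne'⟩
    · rintro ⟨h1, h2⟩
      have : (Hmat W β).PosSemidef := Matrix.PosSemidef.of_dotProduct_mulVec_nonneg (Hmat_herm W hW β)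
        (fun x => by simpa using h1 x)
      exact this.posDef_iff_det_ne_zero.mpr h2
  have hc := Hmat_cont W
  rw [this]
  refine MeasurableSet.inter (IsClosed.measurableSet (isClosed_iInter fun x => ?_)) ?_
  · exact isClosed_le (by fun_prop) (by fun_prop)
  · exact (isOpen_ne_fun (by fun_prop) (by fun_prop)).measurableSet

lemma quadinv_meas (W : Matrix V V ℝ) (η : V → ℝ) : Measurable (fun β => η ⬝ᵥ (Hmat W β)⁻¹ *ᵥ η) := by
  have hc := Hmat_cont W
  have : (fun β => η ⬝ᵥ (Hmat W β)⁻¹ *ᵥ η) = fun β => (Hmat W β).det⁻¹ * (η ⬝ᵥ (Hmat W β).adjugate *ᵥ η) := by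
    funext β
    rw [Matrix.inv_def, Matrix.smul_mulVec, dotProduct_smul, Ring.inverse_eq_inv', smul_eq_mul]
  rw [this]
  have h1 : Continuous (fun β => (Hmat W β).det) := by fun_prop
  have h2 : Continuous (fun β => η ⬝ᵥ (Hmat W β).adjugate *ᵥ η) := by fun_prop
  exact h1.measurable.inv.mul h2.measurable

lemma Ffun_meas (W : Matrix V V ℝ) (η θ : V → ℝ) : Measurable (Ffun W η θ) := by
  have hc := Hmat_cont W
  have h1 : Continuous (fun β => (Hmat W β).det) := by fun_prop
  have h2 : Continuous (fun β => θ ⬝ᵥ (Hmat W β) *ᵥ θ) := by fun_prop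
  have h3 := quadinv_meas W η
  unfold Ffun
  exact ((h2.measurable.add h3).const_mul _).exp.div h1.measurable.sqrt

lemma Find_meas (W : Matrix V V ℝ) (hW : W.IsSymm) (η θ : V → ℝ) : Measurable (Find W η θ) :=
  (Ffun_meas W η θ).ennreal_ofReal.indicator (dom_meas W hW)

lemma Hmat_blk (W : Matrix (Unit ⊕ V) (Unit ⊕ V) ℝ) (hW : W.IsSymm) (b : ℝ) (β : V → ℝ) :
    Hmat W (Sum.elim (fun _ => b) β) = blk (2 * b - W (Sum.inl ()) (Sum.inl ()))
      (fun i => W (Sum.inl ()) (Sum.inr i)) (Hmat (W.submatrix Sum.inr Sum.inr) β) := by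
  ext (i | i) (j | j)
  · simp [Hmat_eq, blk]
  · simp [Hmat_eq, blk]
  · simp [Hmat_eq, blk, hW.apply]
  · simp [Hmat_eq, blk, Matrix.diagonal_apply]

lemma step_inner (W : Matrix (Unit ⊕ V) (Unit ⊕ V) ℝ) (hW : W.IsSymm) (hnn : ∀ i j, 0 ≤ W i j)
    (e t : ℝ) (η θ : V → ℝ) (he : 0 ≤ e) (ht : 0 < t) (hη : ∀ i, 0 ≤ η i) (β : V → ℝ) :
    ∫⁻ b : ℝ, Find W (Sum.elim (fun _ => e) η) (Sum.elim (fun _ => t) θ) (Sum.elim (fun _ => b) β) =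
      ENNReal.ofReal (Real.sqrt (Real.pi/2) / t *
          Real.exp (-(e * t) + t * ((fun i => W (Sum.inl ()) (Sum.inr i)) ⬝ᵥ θ))) *
        Find (W.submatrix Sum.inr Sum.inr) (η + t • (fun i => W (Sum.inl ()) (Sum.inr i))) θ β := by
  set w : V → ℝ := fun i => W (Sum.inl ()) (Sum.inr i) with hw
  set W' := W.submatrix Sum.inr Sum.inr with hW'
  set D := Hmat W' β with hD
  set p0 := W (Sum.inl ()) (Sum.inl ()) with hp0
  by_cases hpd : D.PosDef
  · have hsym : η ⬝ᵥ D⁻¹ *ᵥ w = w ⬝ᵥ D⁻¹ *ᵥ η := by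
      have ht : (D⁻¹)ᵀ = D⁻¹ := by
        have := hpd.inv.isHermitian
        simpa [Matrix.IsHermitian] using this
      rw [dotProduct_mulVec, ← mulVec_transpose, ht, dotProduct_comm]
    set s := p0 + w ⬝ᵥ D⁻¹ *ᵥ w with hs
    set c := e + w ⬝ᵥ D⁻¹ *ᵥ η with hc
    have hc0 : 0 ≤ c := by
      have hm := aux_mmatrix D hpd (fun i j hij => by
        simp [hD, Hmat_eq, Matrix.diagonal_apply_ne _ hij, hW', hnn]) η hη
      exact add_nonneg he (Finset.sum_nonneg fun i _ => mul_nonneg (hnn _ _) (hm i))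
    have hR : Find W' (η + t • w) θ β = ENNReal.ofReal (Ffun W' (η + t • w) θ β) :=
      Set.indicator_of_mem (s := {β : V → ℝ | (Hmat W' β).PosDef}) hpd _
    have key : ∀ b : ℝ, Find W (Sum.elim (fun _ => e) η) (Sum.elim (fun _ => t) θ) (Sum.elim (fun _ => b) β) =
        ENNReal.ofReal (Real.exp (t * c - e * t + t * (w ⬝ᵥ θ)) * Ffun W' (η + t • w) θ β) *
        Set.indicator {b : ℝ | 0 < 2*b - s} (fun b => ENNReal.ofReal
      (Real.exp (-(1/2) * (t^2*(2*b-s) + c^2/(2*b-s))) / Real.sqrt (2*b-s))) b := by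
      intro b
      have hH : Hmat W (Sum.elim (fun _ => b) β) = blk (2*b-p0) w D := Hmat_blk W hW b β
      have hgen : ∀ A B C r q : ℝ, A * (B / r) * (C / q) = A * B * C / (r * q) := by
        intros; simp only [div_eq_mul_inv, mul_inv]; ring
      have hy : 2 * b - p0 - w ⬝ᵥ D⁻¹ *ᵥ w = 2 * b - s := by rw [hs]; ring
      have hiff := blk_posDef (2*b-p0) w D hpd
      rw [hy] at hiff
      by_cases hb : 0 < 2*b - s
      · have hmem : (Hmat W (Sum.elim (fun _ => b) β)).PosDef := by rw [hH]; exact hiff.mpr hb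
        rw [Find, Set.indicator_of_mem (s := {β | (Hmat W β).PosDef}) hmem,
          Set.indicator_of_mem (s := {b : ℝ | 0 < 2*b - s}) hb,
          ← ENNReal.ofReal_mul (by unfold Ffun; positivity)]
        congr 1
        unfold Ffun
        rw [hH, blk_inv _ _ _ hpd (by rw [hy]; exact hb), blk_det _ _ _ hpd, hy, blk_mulVec, blk_dot,
          Real.sqrt_mul hpd.det_pos.le, ← hD, hgen, ← Real.exp_add, ← Real.exp_add]
        congr 2
        simp only [Matrix.mulVec_add, Matrix.mulVec_smul, dotProduct_add, dotProduct_smul, smul_eq_mul,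
          add_dotProduct, smul_dotProduct, dotProduct_sub, hsym]
        rw [dotProduct_comm θ w]
        have h2 : w ⬝ᵥ D⁻¹ *ᵥ η = c - e := by rw [hc]; ring
        have h3 : w ⬝ᵥ D⁻¹ *ᵥ w = s - p0 := by rw [hs]; ring
        rw [← hc, h2, h3]
        ring
      · have hmem : ¬ (Hmat W (Sum.elim (fun _ => b) β)).PosDef := by rw [hH]; exact fun h => hb (hiff.mp h)
        rw [Find, Set.indicator_of_notMem (s := {β | (Hmat W β).PosDef}) hmem,
          Set.indicator_of_notMem (s := {b : ℝ | 0 < 2*b - s}) hb, mul_zero]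
    simp_rw [key]
    rw [lintegral_const_mul' _ _ ENNReal.ofReal_ne_top, aux_J t c s ht hc0, hR,
      ← ENNReal.ofReal_mul (by unfold Ffun; positivity), ← ENNReal.ofReal_mul (by positivity)]
    congr 1
    have : Real.exp (-(e * t) + t * (w ⬝ᵥ θ)) = Real.exp (t * c - e * t + t * (w ⬝ᵥ θ)) * Real.exp (-(t*c)) := by
      rw [← Real.exp_add]; congr 1; ring
    rw [this]
    ring
  · have hR : Find W' (η + t • w) θ β = 0 :=
      Set.indicator_of_notMem (s := {β : V → ℝ | (Hmat W' β).PosDef}) hpd _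
    rw [hR, mul_zero]
    have : ∀ b : ℝ, Find W (Sum.elim (fun _ => e) η) (Sum.elim (fun _ => t) θ) (Sum.elim (fun _ => b) β) = 0 := by
      intro b
      refine Set.indicator_of_notMem (s := {β | (Hmat W β).PosDef}) (fun h => hpd ?_) _
      have h' : (Hmat W (Sum.elim (fun _ => b) β)).PosDef := h
      rw [Hmat_blk W hW] at h'
      exact h'.submatrix (e := Sum.inr) Sum.inr_injective
    simp [this]

lemma step (h : MainP V) : MainP (Unit ⊕ V) := by
  intro W hW hnn η θ hη hθ
  obtain ⟨e, η', rfl⟩ : ∃ e η', η = Sum.elim (fun _ => e) η' :=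
    ⟨η (Sum.inl ()), fun i => η (Sum.inr i), by ext (i | i) <;> rfl⟩
  obtain ⟨t, θ', rfl⟩ : ∃ e η', θ = Sum.elim (fun _ => e) η' :=
    ⟨θ (Sum.inl ()), fun i => θ (Sum.inr i), by ext (i | i) <;> rfl⟩
  have he : 0 ≤ e := hη (Sum.inl ())
  have ht : 0 < t := hθ (Sum.inl ())
  have hη' : ∀ i, 0 ≤ η' i := fun i => hη (Sum.inr i)
  have hθ' : ∀ i, 0 < θ' i := fun i => hθ (Sum.inr i)
  set w : V → ℝ := fun i => W (Sum.inl ()) (Sum.inr i) with hw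
  have hW' : (W.submatrix Sum.inr Sum.inr : Matrix V V ℝ).IsSymm := hW.submatrix _
  have hm := Find_meas W hW (Sum.elim (fun _ => e) η') (Sum.elim (fun _ => t) θ')
  rw [← (volume_measurePreserving_sumPiEquivProdPi_symm (fun _ : Unit ⊕ V => ℝ)).lintegral_comp hm,
    Measure.volume_eq_prod]
  have hm2 : Measurable (fun a : (Unit → ℝ) × (V → ℝ) => Find W (Sum.elim (fun _ => e) η') (Sum.elim (fun _ => t) θ')
      ((MeasurableEquiv.sumPiEquivProdPi (fun _ : Unit ⊕ V => ℝ)).symm a)) :=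
    hm.comp (MeasurableEquiv.measurable _)
  rw [lintegral_prod_symm' _ hm2]
  have hin : ∀ β : V → ℝ, ∫⁻ x : Unit → ℝ, Find W (Sum.elim (fun _ => e) η') (Sum.elim (fun _ => t) θ')
      ((MeasurableEquiv.sumPiEquivProdPi (fun _ : Unit ⊕ V => ℝ)).symm (x, β)) =
      ∫⁻ b : ℝ, Find W (Sum.elim (fun _ => e) η') (Sum.elim (fun _ => t) θ') (Sum.elim (fun _ => b) β) := by
    intro β
    rw [← (volume_preserving_funUnique Unit ℝ).lintegral_comp_emb (MeasurableEquiv.measurableEmbedding _)]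
    refine lintegral_congr fun x => ?_
    congr 1
  simp_rw [hin, step_inner W hW hnn e t η' θ' he ht hη']
  rw [lintegral_const_mul' _ _ ENNReal.ofReal_ne_top,
    h _ hW' (fun i j => hnn _ _) (η' + t • w) _ (fun i => add_nonneg (hη' i) (mul_nonneg ht.le (hnn _ _))) hθ',
    ← ENNReal.ofReal_mul (by positivity)]
  congr 1
  rw [Fintype.prod_sum_type, blk_dot, add_dotProduct, smul_dotProduct]
  simp only [Finset.univ_unique, Finset.prod_singleton, Sum.elim_inl, Sum.elim_inr, smul_eq_mul]
  have : ∀ A B x y z : ℝ, A * Real.exp x * (B * Real.exp y) = A * B * Real.exp (x + y) := by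
    intros; rw [Real.exp_add]; ring
  rw [this _ _ _ _ 0]
  congr 2
  ring

lemma transp {V' : Type*} [Fintype V'] [DecidableEq V'] (f : V ≃ V') (h : MainP V) : MainP V' := by
  intro W hW hnn η θ hη hθ
  have hm := Find_meas W hW η θ
  have hh := h (W.submatrix f f) (hW.submatrix _) (fun i j => hnn _ _) (η ∘ f) (θ ∘ f) (fun i => hη _) (fun i => hθ _)
  rw [← (volume_measurePreserving_piCongrLeft (fun _ : V' => ℝ) f).lintegral_comp hm]
  have e1 : (∏ i, Real.sqrt (Real.pi/2) / θ i) = ∏ i, Real.sqrt (Real.pi/2) / (θ ∘ f) i :=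
    (Equiv.prod_comp f (fun i => Real.sqrt (Real.pi/2) / θ i)).symm
  have e2 : η ⬝ᵥ θ = (η ∘ f) ⬝ᵥ (θ ∘ f) := (Equiv.sum_comp f (fun i => η i * θ i)).symm
  rw [e1, e2, ← hh]
  refine lintegral_congr fun β => ?_
  set γ := (MeasurableEquiv.piCongrLeft (fun _ : V' => ℝ) f) β with hγ
  have hβ : β = γ ∘ f := by
    funext i
    exact (MeasurableEquiv.piCongrLeft_apply_apply f (β := fun _ : V' => ℝ) β i).symm
  have hH : Hmat (W.submatrix f f) β = (Hmat W γ).submatrix f f := by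
    ext i j
    simp [Hmat_eq, hβ, Matrix.diagonal_apply]
  have hF : Ffun (W.submatrix f f) (η ∘ f) (θ ∘ f) β = Ffun W η θ γ := by
    unfold Ffun
    have hq : ∀ (M : Matrix V' V' ℝ) (x : V' → ℝ), (x ∘ f) ⬝ᵥ (M.submatrix f f) *ᵥ (x ∘ f) = x ⬝ᵥ M *ᵥ x := by
      intro M x
      simp only [dotProduct, mulVec, Function.comp, submatrix_apply]
      rw [← Equiv.sum_comp f]
      refine Finset.sum_congr rfl fun i _ => ?_
      rw [← Equiv.sum_comp f]
    rw [hH, Matrix.inv_submatrix_equiv, hq, hq, Matrix.det_submatrix_equiv_self]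
  have hP : (Hmat (W.submatrix f f) β).PosDef ↔ (Hmat W γ).PosDef := by
    rw [hH]
    constructor
    · intro h
      have := h.submatrix (e := f.symm) f.symm.injective
      simpa using this
    · intro h
      exact h.submatrix f.injective
  by_cases hp : (Hmat W γ).PosDef
  · rw [Find, Find, Set.indicator_of_mem (s := {β | (Hmat W β).PosDef}) hp,
      Set.indicator_of_mem (s := {β | (Hmat (W.submatrix f f) β).PosDef}) (hP.mpr hp), hF]
  · rw [Find, Find, Set.indicator_of_notMem (s := {β | (Hmat W β).PosDef}) hp,
      Set.indicator_of_notMem (s := {β | (Hmat (W.submatrix f f) β).PosDef}) (fun h => hp (hP.mp h))]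

lemma base : MainP (Fin 0) := by
  intro W hW hnn η θ hη hθ
  have : ∀ β, Find W η θ β = 1 := by
    intro β
    have hp : (Hmat W β).PosDef := by
      rw [Subsingleton.elim (Hmat W β) 1]; exact Matrix.PosDef.one
    rw [Find, Set.indicator_of_mem (s := {β | (Hmat W β).PosDef}) hp, Ffun]
    simp
  simp only [this, lintegral_const, one_mul]
  rw [volume_pi, Measure.pi_of_empty _ 0]
  simp

lemma mainFin : ∀ n, MainP (Fin n)
  | 0 => base
  | n + 1 => transp ((Equiv.sumComm _ _).trans
      ((Equiv.sumCongr (Equiv.refl _) (Equiv.ofUnique Unit (Fin 1))).trans finSumFinEquiv)) (step (mainFin n))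

lemma mainAll (V : Type*) [Fintype V] [DecidableEq V] : MainP V :=
  transp (Fintype.equivFin V).symm (mainFin _)

end main

theorem stmt1 {V : Type*} [Fintype V] [DecidableEq V] [Nonempty V]
    (W : Matrix V V ℝ) (hsymm : W.IsSymm) (hnn : ∀ i j, 0 ≤ W i j)
    (hdiag : ∀ i, W i i = 0) (hconn : (graphOf W).Connected)
    (η : V → ℝ) (hη : ∀ i, 0 ≤ η i)
    (l : V → ℝ) (hl : ∀ i, 0 ≤ l i) :
    ∫ β, Real.exp (-(l ⬝ᵥ β)) ∂(nuMeas W η)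
      = Real.exp (-(∑ i, η i * (Real.sqrt (1 + l i) - 1))
            - (1 / 2) * ∑ i, ∑ j,
                if i = j then 0
                else W i j * (Real.sqrt ((1 + l i) * (1 + l j)) - 1))
          * ∏ i, (1 + l i) ^ (-(1 / 2) : ℝ) := by
  have hW : W.IsSymm := hsymm
  set θ : V → ℝ := fun i => Real.sqrt (1 + l i) with hθ
  have hθ0 : ∀ i, 0 < θ i := fun i => Real.sqrt_pos.mpr (by linarith [hl i])
  have hθ2 : ∀ i, θ i ^ 2 = 1 + l i := fun i => Real.sq_sqrt (by linarith [hl i])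
  have hdens : Measurable (nuDens W η) := by
    have hc := Hmat_cont W
    have h1 : Continuous (fun β => (Hmat W β).det) := by fun_prop
    have h2 : Continuous (fun β => (1 : V → ℝ) ⬝ᵥ (Hmat W β) *ᵥ 1) := by fun_prop
    have h3 := quadinv_meas W η
    unfold nuDens
    exact Measurable.indicator (Measurable.ennreal_ofReal
      (((((h2.measurable.add h3).const_mul _).add_const _).exp.const_mul _).div h1.measurable.sqrt)) (dom_meas W hW)
  have hcont : Continuous (fun β : V → ℝ => Real.exp (-(l ⬝ᵥ β))) := by fun_prop
  rw [integral_eq_lintegral_of_nonneg_ae (Filter.Eventually.of_forall fun x => (Real.exp_pos _).le)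
    hcont.aestronglyMeasurable, nuMeas,
    lintegral_withDensity_eq_lintegral_mul _ hdens hcont.measurable.ennreal_ofReal]
  set C : ℝ := (2 / Real.pi) ^ ((Fintype.card V : ℝ) / 2) *
    Real.exp (η ⬝ᵥ (1 : V → ℝ) + (1/2) * ((1 : V → ℝ) ⬝ᵥ W *ᵥ 1) - (1/2) * (θ ⬝ᵥ W *ᵥ θ)) with hC
  have hC0 : 0 ≤ C := by positivity
  have hquad : ∀ (β x : V → ℝ), x ⬝ᵥ (Hmat W β) *ᵥ x = 2 * ∑ i, β i * x i ^ 2 - x ⬝ᵥ W *ᵥ x := by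
    intro β x
    rw [Hmat, Matrix.sub_mulVec, dotProduct_sub]
    congr 1
    simp only [Matrix.smul_mulVec, dotProduct, Pi.smul_apply, Matrix.mulVec_diagonal, Finset.mul_sum]
    refine Finset.sum_congr rfl fun i _ => ?_
    simp; ring
  have hpt : ∀ β : V → ℝ, (nuDens W η * fun β => ENNReal.ofReal (Real.exp (-(l ⬝ᵥ β)))) β =
      ENNReal.ofReal C * Find W η θ β := by
    intro β
    rw [Pi.mul_apply]
    by_cases hp : (Hmat W β).PosDef
    · rw [nuDens, Find, Set.indicator_of_mem (s := {β | (Hmat W β).PosDef}) hp,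
        Set.indicator_of_mem (s := {β | (Hmat W β).PosDef}) hp, ← ENNReal.ofReal_mul (by positivity),
        ← ENNReal.ofReal_mul hC0]
      congr 1
      rw [hC, Ffun, hquad, hquad, div_mul_eq_mul_div, mul_div_assoc', mul_assoc, mul_assoc, ← Real.exp_add,
        ← Real.exp_add]
      congr 3
      have : ∑ i, β i * θ i ^ 2 = ∑ i, β i * (1 : V → ℝ) i ^ 2 + l ⬝ᵥ β := by
        rw [dotProduct, ← Finset.sum_add_distrib]
        refine Finset.sum_congr rfl fun i _ => ?_
        rw [hθ2]; simp; ring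
      rw [this]
      ring
    · rw [nuDens, Find, Set.indicator_of_notMem (s := {β | (Hmat W β).PosDef}) hp,
        Set.indicator_of_notMem (s := {β | (Hmat W β).PosDef}) hp, zero_mul, mul_zero]
  rw [lintegral_congr hpt, lintegral_const_mul' _ _ ENNReal.ofReal_ne_top, mainAll V W hW hnn η θ hη hθ0,
    ← ENNReal.ofReal_mul hC0, ENNReal.toReal_ofReal (mul_nonneg hC0 (mul_nonneg
      (Finset.prod_nonneg fun i _ => div_nonneg (Real.sqrt_nonneg _) (hθ0 i).le) (Real.exp_pos _).le))]
  have hprod : (2 / Real.pi) ^ ((Fintype.card V : ℝ) / 2) * (∏ i, Real.sqrt (Real.pi/2) / θ i) =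
      ∏ i, (1 + l i) ^ (-(1 / 2) : ℝ) := by
    have h1 : (2 / Real.pi) ^ ((Fintype.card V : ℝ) / 2) = ∏ _i : V, Real.sqrt (2/Real.pi) := by
      rw [Finset.prod_const, Finset.card_univ, Real.sqrt_eq_rpow, ← Real.rpow_natCast, ← Real.rpow_mul (by positivity)]
      congr 1; ring
    rw [h1, ← Finset.prod_mul_distrib]
    refine Finset.prod_congr rfl fun i _ => ?_
    rw [mul_div_assoc', ← Real.sqrt_mul (by positivity), Real.rpow_neg (by linarith [hl i]), ← Real.sqrt_eq_rpow]
    have : 2 / Real.pi * (Real.pi / 2) = 1 := by field_simp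
    rw [this, Real.sqrt_one, one_div]
  have hexp : η ⬝ᵥ (1 : V → ℝ) + (1/2) * ((1 : V → ℝ) ⬝ᵥ W *ᵥ 1) - (1/2) * (θ ⬝ᵥ W *ᵥ θ) + -(η ⬝ᵥ θ) =
      -(∑ i, η i * (Real.sqrt (1 + l i) - 1))
            - (1 / 2) * ∑ i, ∑ j,
                if i = j then 0
                else W i j * (Real.sqrt ((1 + l i) * (1 + l j)) - 1) := by
    have h1 : ∑ i, η i * (Real.sqrt (1 + l i) - 1) = η ⬝ᵥ θ - η ⬝ᵥ (1 : V → ℝ) := by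
      simp only [dotProduct, ← Finset.sum_sub_distrib, hθ]
      refine Finset.sum_congr rfl fun i _ => ?_
      simp; ring
    have h2 : (∑ i, ∑ j, if i = j then 0 else W i j * (Real.sqrt ((1 + l i) * (1 + l j)) - 1)) =
        θ ⬝ᵥ W *ᵥ θ - (1 : V → ℝ) ⬝ᵥ W *ᵥ 1 := by
      simp only [dotProduct, mulVec, ← Finset.sum_sub_distrib, Finset.mul_sum]
      refine Finset.sum_congr rfl fun i _ => Finset.sum_congr rfl fun j _ => ?_
      split_ifs with hij
      · subst hij; simp [hdiag]
      · rw [Real.sqrt_mul (by linarith [hl i])]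
        simp [hθ]; ring
    rw [h1, h2]
    ring
  rw [← hexp, ← hprod, hC, Real.exp_add _ (-(η ⬝ᵥ θ))]
  ring

end
end
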